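/- Let r ∈ (0,1) and let A, B ⊂ ℝ be finite sets with |A| = |B| = n ≥ 2. Suppose the homogeneous IFSs Φ = {x ↦ r·x + a : a ∈ A} and Ψ = {x ↦ -r·x + b : b ∈ B} have the same attractor K ⊂ ℝ (K nonempty compact, not a singleton), and both satisfy the open set condition. Then K is symmetric: there exists c ∈ ℝ with K = {c - x : x ∈ K}. (Feng–Wang Open Question 1, answered affirmatively.) -/

import Mathlib

/-- The open set condition for the homogeneous IFS `{x ↦ ρ x + t : t ∈ T}`. -/
def OSCset (ρ : ℝ) (T : Set ℝ) : Prop :=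
  ∃ U : Set ℝ, U.Nonempty ∧ IsOpen U ∧ Bornology.IsBounded U ∧
    (⋃ t ∈ T, (fun x => ρ * x + t) '' U) ⊆ U ∧
    T.PairwiseDisjoint fun t => (fun x => ρ * x + t) '' U

/-- `S` is the translation set of a homogeneous system of ratio `ρ` which leaves `K` invariant and
satisfies the open set condition with the set `U`. -/
structure SeparatedSystem (ρ : ℝ) (S : Finset ℝ) (U K : Set ℝ) : Prop where
  cover : ∀ x ∈ K, ∃ s ∈ S, ∃ y ∈ K, x = s + ρ * y
  maps_attractor : ∀ s ∈ S, ∀ y ∈ K, s + ρ * y ∈ K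
  maps_open : ∀ s ∈ S, ∀ u ∈ U, s + ρ * u ∈ U
  inj : ∀ s ∈ S, ∀ t ∈ S, ∀ u ∈ U, ∀ v ∈ U, s + ρ * u = t + ρ * v → s = t

/-- The translation set of the composition of two homogeneous systems, the first of ratio `ρ`. -/
noncomputable def compTranslations (ρ : ℝ) (S T : Finset ℝ) : Finset ℝ :=
  Finset.image₂ (fun s t => s + ρ * t) S T

theorem mem_compTranslations {ρ : ℝ} {S T : Finset ℝ} {x : ℝ} :
    x ∈ compTranslations ρ S T ↔ ∃ s ∈ S, ∃ t ∈ T, s + ρ * t = x :=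
  Finset.mem_image₂

/-- The translation set of the `k`-th iterate of a homogeneous system. -/
noncomputable def iterTranslations (ρ : ℝ) (S : Finset ℝ) : ℕ → Finset ℝ
  | 0 => {0}
  | k + 1 => compTranslations ρ S (iterTranslations ρ S k)

theorem add_mem_iterTranslations {ρ : ℝ} {S : Finset ℝ} {j k : ℕ} {u w : ℝ}
    (hu : u ∈ iterTranslations ρ S j) (hw : w ∈ iterTranslations ρ S k) :
    u + ρ ^ j * w ∈ iterTranslations ρ S (j + k) := by
  induction j generalizing u with
  | zero =>
    rw [iterTranslations, Finset.mem_singleton] at hu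
    simpa [hu] using hw
  | succ j ih =>
    obtain ⟨s, hs, t, ht, rfl⟩ := mem_compTranslations.1 hu
    rw [Nat.succ_add]
    exact mem_compTranslations.2 ⟨s, hs, _, ih ht, by ring⟩

namespace SeparatedSystem

variable {ρ σ : ℝ} {S T : Finset ℝ} {U K : Set ℝ}

theorem fst_eq (hS : SeparatedSystem ρ S U K) (hT : SeparatedSystem σ T U K) (hU : U.Nonempty)
    {s s' t t' : ℝ} (hs : s ∈ S) (hs' : s' ∈ S) (ht : t ∈ T) (ht' : t' ∈ T)
    (h : s + ρ * t = s' + ρ * t') : s = s' := by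
  obtain ⟨x, hx⟩ := hU
  exact hS.inj s hs s' hs' _ (hT.maps_open t ht x hx) _ (hT.maps_open t' ht' x hx)
    (by linear_combination h)

theorem comp (hS : SeparatedSystem ρ S U K) (hT : SeparatedSystem σ T U K) (hρ : ρ ≠ 0) :
    SeparatedSystem (ρ * σ) (compTranslations ρ S T) U K where
  cover x hx := by
    obtain ⟨s, hs, y, hy, rfl⟩ := hS.cover x hx
    obtain ⟨t, ht, z, hz, rfl⟩ := hT.cover y hy
    exact ⟨_, mem_compTranslations.2 ⟨s, hs, t, ht, rfl⟩, z, hz, by ring⟩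
  maps_attractor x hx y hy := by
    obtain ⟨s, hs, t, ht, rfl⟩ := mem_compTranslations.1 hx
    convert hS.maps_attractor s hs _ (hT.maps_attractor t ht y hy) using 1
    ring
  maps_open x hx y hy := by
    obtain ⟨s, hs, t, ht, rfl⟩ := mem_compTranslations.1 hx
    convert hS.maps_open s hs _ (hT.maps_open t ht y hy) using 1
    ring
  inj x hx x' hx' u hu u' hu' h := by
    obtain ⟨s, hs, t, ht, rfl⟩ := mem_compTranslations.1 hx
    obtain ⟨s', hs', t', ht', rfl⟩ := mem_compTranslations.1 hx'
    obtain rfl : s = s' := hS.inj s hs s' hs' _ (hT.maps_open t ht u hu) _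
      (hT.maps_open t' ht' u' hu') (by linear_combination h)
    have h2 : t + σ * u = t' + σ * u' :=
      mul_left_cancel₀ hρ (by linear_combination h)
    rw [hT.inj t ht t' ht' u hu u' hu' h2]

theorem iter (hS : SeparatedSystem ρ S U K) (hρ : ρ ≠ 0) (k : ℕ) :
    SeparatedSystem (ρ ^ k) (iterTranslations ρ S k) U K := by
  induction k with
  | zero => constructor <;> simp [iterTranslations]
  | succ k ih =>
    rw [pow_succ']
    exact hS.comp ih hρ

/-- The translations of a separated system of ratio `ρ` are `δ ρ`-separated, with `δ` depending
only on the open set; hence a translation has boundedly many neighbours at scale `ρ`. -/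
theorem exists_card_neighbours_le (hU : U.Nonempty) (hUo : IsOpen U) (c : ℝ) :
    ∃ C : ℕ, ∀ (ρ : ℝ) (S : Finset ℝ), 0 < ρ → SeparatedSystem ρ S U K → ∀ w,
      (S.filter fun v => |v - w| ≤ c * ρ).card ≤ C := by
  obtain ⟨p, hp⟩ := hU
  obtain ⟨δ, hδ, hball⟩ := Metric.isOpen_iff.1 hUo p hp
  refine ⟨(Finset.Icc ⌊-c / δ⌋ ⌊c / δ⌋).card, fun ρ S hρ hS w => ?_⟩
  have hδρ : 0 < δ * ρ := mul_pos hδ hρ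
  refine Finset.card_le_card_of_injOn (fun v => ⌊(v - w) / (δ * ρ)⌋) ?_ ?_
  · intro v hv
    obtain ⟨hv1, hv2⟩ := abs_le.1 (Finset.mem_filter.1 hv).2
    refine Finset.mem_coe.2 (Finset.mem_Icc.2 ⟨Int.floor_mono ?_, Int.floor_mono ?_⟩)
    · rw [div_le_div_iff₀ hδ hδρ]
      nlinarith
    · rw [div_le_div_iff₀ hδρ hδ]
      nlinarith
  · intro v hv v' hv' h
    have hlt := Int.abs_sub_lt_one_of_floor_eq_floor h
    rw [← sub_div, abs_div, abs_of_pos hδρ, div_lt_one hδρ] at hlt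
    refine hS.inj v (Finset.mem_filter.1 hv).1 v' (Finset.mem_filter.1 hv').1 p hp
      (p + (v - v') / ρ) (hball ?_) (by field_simp; ring)
    rw [Metric.mem_ball, Real.dist_eq, add_sub_cancel_left, abs_div, abs_of_pos hρ, div_lt_iff₀ hρ]
    convert hlt using 2
    ring

/-- Some cylinder of a separated system has, inside every other cylinder, a copy that is disjoint
from all remaining cylinders of the same generation. -/
theorem exists_isolated_cylinder (hS : SeparatedSystem ρ S U K) (hρ : 0 < ρ) (hU : U.Nonempty)
    (hUo : IsOpen U) (hK : IsCompact K) :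
    ∃ k, ∃ w ∈ iterTranslations ρ S k, ∀ j, ∀ u ∈ iterTranslations ρ S j,
      ∀ u' ∈ iterTranslations ρ S j, ∀ x ∈ K, ∀ y ∈ K,
        u + ρ ^ j * (w + ρ ^ k * x) = u' + ρ ^ j * y → u = u' := by
  set c := Metric.diam K
  obtain ⟨C, hC⟩ := exists_card_neighbours_le (K := K) hU hUo c
  let N : ℕ → ℝ → Finset ℝ := fun k w =>
    (iterTranslations ρ S k).filter fun v => |v - w| ≤ c * ρ ^ k
  have hN : ∀ k w, (N k w).card ≤ C := fun k w =>
    hC _ _ (pow_pos hρ k) (hS.iter hρ.ne' k) w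
  let P : ℕ → Prop := fun m => ∃ k, ∃ w ∈ iterTranslations ρ S k, (N k w).card = m
  obtain ⟨M, ⟨k, w, hw, hM⟩, hmax⟩ : ∃ M, P M ∧ ∀ m, P m → m ≤ M := by
    classical
    have h0 : P (N 0 0).card := ⟨0, 0, by simp [iterTranslations], rfl⟩
    refine ⟨Nat.findGreatest P C, Nat.findGreatest_spec (hN 0 0) h0, fun m hm => ?_⟩
    obtain ⟨k, w, -, rfl⟩ := id hm
    exact Nat.le_findGreatest (hN k w) hm
  refine ⟨k, w, hw, fun j u hu u' hu' x hx y hy h => ?_⟩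
  have hj := pow_pos hρ j
  have hk := pow_pos hρ k
  have himage : (N k w).image (fun v => u + ρ ^ j * v) = N (j + k) (u + ρ ^ j * w) := by
    refine Finset.eq_of_subset_of_card_le ?_ ?_
    · intro z hz
      obtain ⟨v, hv, rfl⟩ := Finset.mem_image.1 hz
      obtain ⟨hv, hvw⟩ := Finset.mem_filter.1 hv
      refine Finset.mem_filter.2 ⟨add_mem_iterTranslations hu hv, ?_⟩
      rw [add_sub_add_left_eq_sub, ← mul_sub, abs_mul, abs_of_pos hj, pow_add]
      nlinarith
    · rw [Finset.card_image_of_injective, hM]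
      · exact hmax _ ⟨_, _, add_mem_iterTranslations hu hw, rfl⟩
      · intro a b hab
        exact mul_left_cancel₀ hj.ne' (add_left_cancel hab)
  obtain ⟨v, hv, y', hy', rfl⟩ := (hS.iter hρ.ne' k).cover y hy
  have hmem : u' + ρ ^ j * v ∈ N (j + k) (u + ρ ^ j * w) := by
    refine Finset.mem_filter.2 ⟨add_mem_iterTranslations hu' hv, ?_⟩
    have hdiff : u' + ρ ^ j * v - (u + ρ ^ j * w) = (x - y') * ρ ^ (j + k) := by
      rw [pow_add]
      linear_combination -h
    rw [hdiff, abs_mul, abs_of_pos (pow_pos hρ _)]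
    exact mul_le_mul_of_nonneg_right (Metric.dist_le_diam_of_mem hK.isBounded hx hy')
      (pow_pos hρ _).le
  rw [← himage] at hmem
  obtain ⟨v', hv', hvv'⟩ := Finset.mem_image.1 hmem
  have hvS := (Finset.mem_filter.1 hv').1
  exact (hS.iter hρ.ne' j).fst_eq (hS.iter hρ.ne' k) hU hu hu' hvS hv (by rw [hvv'])

/-- In each piece of the attractor, the points that lie in no other piece are dense. -/
theorem exists_near_notMem_other (hS : SeparatedSystem ρ S U K) (hρ : 0 < ρ) (hρ1 : ρ < 1)
    (hU : U.Nonempty) (hUo : IsOpen U) (hK : IsCompact K) {t p ε : ℝ} (ht : t ∈ S) (hp : p ∈ K)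
    (hε : 0 < ε) :
    ∃ q ∈ K, |q - p| < ε ∧ ∀ s ∈ S, ∀ y ∈ K, t + ρ * q = s + ρ * y → s = t := by
  obtain ⟨k, w, hw, hsep⟩ := hS.exists_isolated_cylinder hρ hU hUo hK
  obtain ⟨m, hm⟩ : ∃ m : ℕ, ρ ^ m * (Metric.diam K + 1) < ε := by
    have hD : 0 < Metric.diam K + 1 := by linarith [Metric.diam_nonneg (s := K)]
    obtain ⟨m, hm⟩ := exists_pow_lt_of_lt_one (div_pos hε hD) hρ1
    exact ⟨m, (lt_div_iff₀ hD).1 hm⟩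
  have hm0 := pow_pos hρ m
  have hSm := hS.iter hρ.ne' m
  obtain ⟨v, hv, p', hp', rfl⟩ := hSm.cover p hp
  have hq' : w + ρ ^ k * p' ∈ K := (hS.iter hρ.ne' k).maps_attractor w hw p' hp'
  refine ⟨v + ρ ^ m * (w + ρ ^ k * p'), hSm.maps_attractor v hv _ hq', ?_, ?_⟩
  · rw [add_sub_add_left_eq_sub, ← mul_sub, abs_mul, abs_of_pos hm0]
    have hdist := Metric.dist_le_diam_of_mem hK.isBounded hq' hp'
    rw [Real.dist_eq] at hdist
    nlinarith
  · intro s hs y hy h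
    obtain ⟨v', hv', y', hy', rfl⟩ := hSm.cover y hy
    have heq := hsep (m + 1) (t + ρ * v) (mem_compTranslations.2 ⟨t, ht, v, hv, rfl⟩)
      (s + ρ * v') (mem_compTranslations.2 ⟨s, hs, v', hv', rfl⟩) p' hp' y' hy'
      (by rw [pow_succ']; linear_combination h)
    exact (hS.fst_eq hSm hU ht hs hv hv' heq).symm

end SeparatedSystem

theorem forall_of_finite_not_of_lt {α : Type*} [LinearOrder α] {P : α → Prop}
    (hfin : {t | ¬ P t}.Finite) (ih : ∀ t, (∀ s < t, P s) → P t) (t : α) : P t := by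
  by_contra ht
  obtain ⟨m, hm, hmin⟩ := Set.exists_min_image _ id hfin ⟨t, ht⟩
  exact hm (ih m fun s hs => by_contra fun h => (hmin s h).not_gt hs)

theorem Finset.eq_of_mem_iff_of_lt {α : Type*} [LinearOrder α] {S T : Finset α}
    (h : ∀ t ∈ S, (∀ s < t, s ∈ S ↔ s ∈ T) → t ∈ T)
    (h' : ∀ t ∈ T, (∀ s < t, s ∈ S ↔ s ∈ T) → t ∈ S) : S = T := by
  refine Finset.ext (forall_of_finite_not_of_lt ((S ∪ T).finite_toSet.subset fun t ht => ?_)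
    fun t ih => ⟨fun ht => h t ht ih, fun ht => h' t ht ih⟩)
  by_contra hn
  simp only [Finset.mem_coe, Finset.mem_union, not_or] at hn
  exact ht ⟨fun hs => absurd hs hn.1, fun hs => absurd hs hn.2⟩

namespace SeparatedSystem

variable {ρ : ℝ} {S T : Finset ℝ} {U V K : Set ℝ}

theorem mem_of_forall_lt (hS : SeparatedSystem ρ S U K) (hT : SeparatedSystem ρ T V K)
    (hρ : 0 < ρ) (hρ1 : ρ < 1) (hU : U.Nonempty) (hUo : IsOpen U) (hK : IsCompact K)
    (hKne : K.Nonempty) {t : ℝ} (ht : t ∈ S) (hlt : ∀ s < t, s ∈ T → s ∈ S) : t ∈ T := by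
  by_contra htT
  obtain ⟨p, hp, hmin⟩ := hK.exists_isMinOn hKne continuousOn_id
  obtain ⟨ε, hε, hgap⟩ : ∃ ε > 0, ∀ s ∈ T, t < s → t + ε ≤ s := by
    rcases (T.filter (t < ·)).eq_empty_or_nonempty with h | h
    · refine ⟨1, one_pos, fun s hs hts => ?_⟩
      have := Finset.mem_filter.2 ⟨hs, hts⟩
      simp [h] at this
    · obtain ⟨m, hm, hmin⟩ := Finset.exists_min_image _ id h
      refine ⟨m - t, sub_pos.2 (Finset.mem_filter.1 hm).2, fun s hs hts => ?_⟩
      have := hmin s (Finset.mem_filter.2 ⟨hs, hts⟩)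
      simp only [id] at this
      linarith
  obtain ⟨q, hq, hqp, hsep⟩ :=
    hS.exists_near_notMem_other hρ hρ1 hU hUo hK ht hp (div_pos hε hρ)
  obtain ⟨s, hs, y, hy, h⟩ := hT.cover _ (hS.maps_attractor t ht q hq)
  have hpy : p ≤ y := hmin hy
  have hqp' : (q - p) * ρ < ε := (lt_div_iff₀ hρ).1 (lt_of_abs_lt hqp)
  rcases lt_trichotomy s t with hst | rfl | hst
  · exact hst.ne (hsep s (hlt s hst hs) y hy h)
  · exact htT hs
  · have := hgap s hs hst
    nlinarith

/-- Separated systems of equal positive ratio with the same attractor are equal. -/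
theorem translations_eq (hS : SeparatedSystem ρ S U K) (hT : SeparatedSystem ρ T V K)
    (hρ : 0 < ρ) (hρ1 : ρ < 1) (hU : U.Nonempty) (hUo : IsOpen U) (hV : V.Nonempty)
    (hVo : IsOpen V) (hK : IsCompact K) (hKne : K.Nonempty) : S = T :=
  Finset.eq_of_mem_iff_of_lt
    (fun _ ht h => hS.mem_of_forall_lt hT hρ hρ1 hU hUo hK hKne ht fun s hs => (h s hs).2)
    (fun _ ht h => hT.mem_of_forall_lt hS hρ hρ1 hV hVo hK hKne ht fun s hs => (h s hs).1)

end SeparatedSystem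

theorem OSCset.exists_separatedSystem {ρ : ℝ} {S : Finset ℝ} {K : Set ℝ}
    (h : OSCset ρ (S : Set ℝ)) (hK : K = ⋃ s ∈ S, (fun x => ρ * x + s) '' K) :
    ∃ U : Set ℝ, U.Nonempty ∧ IsOpen U ∧ SeparatedSystem ρ S U K := by
  obtain ⟨U, hU, hUo, -, hmaps, hdisj⟩ := h
  refine ⟨U, hU, hUo, fun x hx => ?_, fun s hs y hy => ?_, fun s hs u hu => ?_,
    fun s hs s' hs' u hu u' hu' h => ?_⟩
  · rw [hK] at hx
    simp only [Set.mem_iUnion, Set.mem_image] at hx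
    obtain ⟨s, hs, y, hy, rfl⟩ := hx
    exact ⟨s, hs, y, hy, add_comm _ _⟩
  · rw [hK]
    exact Set.mem_biUnion hs ⟨y, hy, add_comm _ _⟩
  · exact hmaps (Set.mem_biUnion hs ⟨u, hu, add_comm _ _⟩)
  · refine hdisj.elim_set hs hs' (s + ρ * u) ⟨u, hu, add_comm _ _⟩ ⟨u', hu', ?_⟩
    rw [h]
    exact add_comm _ _

/-- Two direct sums of sets of nonnegative reals containing `0` that coincide have the same
summands, provided the first summand of each meets the second one of the other only in `0`. -/
theorem summands_eq_of_sums_eq {X Y X' Y' : Finset ℝ}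
    (hX : ∀ x ∈ X, 0 ≤ x) (hY : ∀ x ∈ Y, 0 ≤ x) (hX' : ∀ x ∈ X', 0 ≤ x) (hY' : ∀ x ∈ Y', 0 ≤ x)
    (hX0 : 0 ∈ X) (hY0 : 0 ∈ Y) (hX0' : 0 ∈ X') (hY0' : 0 ∈ Y')
    (hdir : ∀ x ∈ X, ∀ y ∈ Y, ∀ z ∈ X, ∀ w ∈ Y, x + y = z + w → x = z)
    (hdir' : ∀ x ∈ X', ∀ y ∈ Y', ∀ z ∈ X', ∀ w ∈ Y', x + y = z + w → x = z)
    (hsub : ∀ x ∈ X, ∀ y ∈ Y, ∃ z ∈ X', ∃ w ∈ Y', x + y = z + w)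
    (hsub' : ∀ x ∈ X', ∀ y ∈ Y', ∃ z ∈ X, ∃ w ∈ Y, x + y = z + w)
    (hcross : ∀ t ∈ X, t ∈ Y' → t = 0) (hcross' : ∀ t ∈ X', t ∈ Y → t = 0) :
    X = X' ∧ Y = Y' := by
  have key : ∀ t, (t ∈ X ↔ t ∈ X') ∧ (t ∈ Y ↔ t ∈ Y') := by
    refine forall_of_finite_not_of_lt
      ((X ∪ X' ∪ (Y ∪ Y')).finite_toSet.subset fun t ht => ?_) fun t ih => ?_
    · by_contra hn
      simp only [Finset.mem_coe, Finset.mem_union, not_or] at hn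
      exact ht (by tauto)
    by_cases ht0 : t = 0
    · simp [ht0, hX0, hX0', hY0, hY0']
    refine ⟨⟨fun ht => ?_, fun ht => ?_⟩, ⟨fun ht => ?_, fun ht => ?_⟩⟩
    · obtain ⟨z, hz, w, hw, h⟩ := hsub t ht 0 hY0
      rw [add_zero] at h
      rcases (hX' z hz).eq_or_lt with rfl | hz0
      · exact absurd (hcross t ht (by simpa [h] using hw)) ht0
      rcases (hY' w hw).eq_or_lt with rfl | hw0
      · simpa [h] using hz
      have := hdir t ht 0 hY0 z ((ih z (by linarith)).1.2 hz) w ((ih w (by linarith)).2.2 hw)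
        (by linarith)
      linarith
    · obtain ⟨z, hz, w, hw, h⟩ := hsub' t ht 0 hY0'
      rw [add_zero] at h
      rcases (hX z hz).eq_or_lt with rfl | hz0
      · exact absurd (hcross' t ht (by simpa [h] using hw)) ht0
      rcases (hY w hw).eq_or_lt with rfl | hw0
      · simpa [h] using hz
      have := hdir' t ht 0 hY0' z ((ih z (by linarith)).1.1 hz) w ((ih w (by linarith)).2.1 hw)
        (by linarith)
      linarith
    · obtain ⟨z, hz, w, hw, h⟩ := hsub 0 hX0 t ht
      rw [zero_add] at h
      rcases (hX' z hz).eq_or_lt with rfl | hz0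
      · simpa [h] using hw
      rcases (hY' w hw).eq_or_lt with rfl | hw0
      · exact absurd (hcross' t (by simpa [h] using hz) ht) ht0
      have := hdir 0 hX0 t ht z ((ih z (by linarith)).1.2 hz) w ((ih w (by linarith)).2.2 hw)
        (by linarith)
      linarith
    · obtain ⟨z, hz, w, hw, h⟩ := hsub' 0 hX0' t ht
      rw [zero_add] at h
      rcases (hX z hz).eq_or_lt with rfl | hz0
      · simpa [h] using hw
      rcases (hY w hw).eq_or_lt with rfl | hw0
      · exact absurd (hcross t (by simpa [h] using hz) ht) ht0
      have := hdir' 0 hX0' t ht z ((ih z (by linarith)).1.1 hz) w ((ih w (by linarith)).2.1 hw)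
        (by linarith)
      linarith
  exact ⟨Finset.ext fun t => (key t).1, Finset.ext fun t => (key t).2⟩

/-- If `K` is covered by its images under a contracting homogeneous system, then it is contained
in every nonempty compact set which the system maps into itself. -/
theorem subset_of_cover_of_maps {r : ℝ} {A : Finset ℝ} {K L : Set ℝ} (hr : 0 < r) (hr1 : r < 1)
    (hK : IsCompact K) (hL : IsCompact L) (hLne : L.Nonempty)
    (hcover : ∀ x ∈ K, ∃ a ∈ A, ∃ y ∈ K, x = a + r * y)
    (hmaps : ∀ a ∈ A, ∀ y ∈ L, a + r * y ∈ L) : K ⊆ L := by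
  obtain ⟨l, hl⟩ := hLne
  obtain ⟨D, hD⟩ := hK.isBounded.subset_closedBall l
  have hstep : ∀ m : ℕ, ∀ x ∈ K, ∃ y ∈ L, |x - y| ≤ r ^ m * D := by
    intro m
    induction m with
    | zero =>
      intro x hx
      exact ⟨l, hl, by simpa [Real.dist_eq] using hD hx⟩
    | succ m ih =>
      intro x hx
      obtain ⟨a, ha, x', hx', rfl⟩ := hcover x hx
      obtain ⟨y, hy, hxy⟩ := ih x' hx'
      refine ⟨a + r * y, hmaps a ha y hy, ?_⟩
      rw [add_sub_add_left_eq_sub, ← mul_sub, abs_mul, abs_of_pos hr, pow_succ', mul_assoc]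
      exact mul_le_mul_of_nonneg_left hxy hr.le
  intro x hx
  rw [← hL.isClosed.closure_eq]
  refine Metric.mem_closure_iff.2 fun ε hε => ?_
  have hlim : Filter.Tendsto (fun m : ℕ => r ^ m * D) Filter.atTop (nhds 0) := by
    simpa using (tendsto_pow_atTop_nhds_zero_of_lt_one hr.le hr1).mul_const D
  obtain ⟨m, hm⟩ := (hlim.eventually_lt_const hε).exists
  obtain ⟨y, hy, hxy⟩ := hstep m x hx
  exact ⟨y, hy, hxy.trans_lt hm⟩

/-- The attractor of a homogeneous system with symmetric translation set is symmetric. -/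
theorem attractor_symmetric {r e : ℝ} {A : Finset ℝ} {K : Set ℝ} (hr : 0 < r) (hr1 : r < 1)
    (hK : IsCompact K) (hKne : K.Nonempty)
    (hcover : ∀ x ∈ K, ∃ a ∈ A, ∃ y ∈ K, x = a + r * y)
    (hmaps : ∀ a ∈ A, ∀ y ∈ K, a + r * y ∈ K) (hsymm : ∀ a ∈ A, e - a ∈ A) :
    ∃ c : ℝ, K = (fun x => c - x) '' K := by
  obtain ⟨c, hc⟩ : ∃ c : ℝ, c - r * c = e :=
    ⟨e / (1 - r), by have : 1 - r ≠ 0 := by linarith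
                     field_simp⟩
  have hsub : K ⊆ (fun x => c - x) '' K := by
    refine subset_of_cover_of_maps hr hr1 hK (hK.image (by fun_prop)) (hKne.image _) hcover ?_
    rintro a ha _ ⟨y, hy, rfl⟩
    exact ⟨_, hmaps _ (hsymm a ha) y hy, by simp only; linear_combination hc⟩
  refine ⟨c, hsub.antisymm ?_⟩
  rintro _ ⟨x, hx, rfl⟩
  obtain ⟨y, hy, rfl⟩ := hsub hx
  simpa using hy

/-- Main theorem (Feng–Wang Open Question 1): if homogeneous IFSs with opposite contraction
factors and the OSC share the attractor `K`, then `K` is symmetric. -/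
theorem stmt_9 (n : ℕ) (hn : 2 ≤ n) (r : ℝ) (hr : 0 < r) (hr1 : r < 1)
    (A B : Finset ℝ) (hAcard : A.card = n) (hBcard : B.card = n)
    (K : Set ℝ) (hKne : K.Nonempty) (hKc : IsCompact K)
    (hKns : ¬ ∃ x, K = {x})
    (hKA : K = ⋃ a ∈ A, (fun x => r * x + a) '' K)
    (hKB : K = ⋃ b ∈ B, (fun x => -r * x + b) '' K)
    (hOSCA : OSCset r (A : Set ℝ)) (hOSCB : OSCset (-r) (B : Set ℝ)) :
    ∃ c : ℝ, K = (fun x => c - x) '' K := by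
  obtain ⟨U, hU, hUo, hA⟩ := hOSCA.exists_separatedSystem hKA
  obtain ⟨V, hV, hVo, hB⟩ := hOSCB.exists_separatedSystem hKB
  have hr' : -r ≠ 0 := neg_ne_zero.2 hr.ne'
  have hAA := hA.comp hA hr.ne'
  have hBB := hB.comp hB hr'
  rw [neg_mul_neg] at hBB
  have hsum := hAA.translations_eq hBB (mul_pos hr hr) (by nlinarith) hU hUo hV hVo hKc hKne
  have hAB : ∀ a ∈ A, ∀ a' ∈ A, ∃ b ∈ B, ∃ b' ∈ B, b + -r * b' = a + r * a' := by
    intro a ha a' ha'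
    exact mem_compTranslations.1 (hsum ▸ mem_compTranslations.2 ⟨a, ha, a', ha', rfl⟩)
  have hBA : ∀ b ∈ B, ∀ b' ∈ B, ∃ a ∈ A, ∃ a' ∈ A, a + r * a' = b + -r * b' := by
    intro b hb b' hb'
    exact mem_compTranslations.1 (hsum ▸ mem_compTranslations.2 ⟨b, hb, b', hb', rfl⟩)
  have hAne : A.Nonempty := Finset.card_pos.1 (by omega)
  have hBne : B.Nonempty := Finset.card_pos.1 (by omega)
  obtain ⟨a₀, ha₀, hamin⟩ := A.exists_min_image id hAne
  obtain ⟨b₀, hb₀, hbmin⟩ := B.exists_min_image id hBne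
  obtain ⟨b₁, hb₁, hbmax⟩ := B.exists_max_image id hBne
  simp only [id] at hamin hbmin hbmax
  have hmin : a₀ + r * a₀ = b₀ - r * b₁ := by
    obtain ⟨b, hb, b', hb', h⟩ := hAB a₀ ha₀ a₀ ha₀
    obtain ⟨a, ha, a', ha', h'⟩ := hBA b₀ hb₀ b₁ hb₁
    nlinarith [hamin a ha, hamin a' ha', hbmin b hb, hbmax b' hb']
  have hcrossAB : ∀ a ∈ A, ∀ a' ∈ A, ∀ b ∈ B, ∀ b' ∈ B, a + r * b = a' + r * b' → a = a' := by
    intro a ha a' ha' b hb b' hb' h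
    obtain ⟨x, hx, y, hy, hxy⟩ := hBA b hb b₀ hb₀
    obtain ⟨x', hx', y', hy', hxy'⟩ := hBA b' hb' b₀ hb₀
    exact hA.fst_eq hAA hU ha ha' (mem_compTranslations.2 ⟨x, hx, y, hy, rfl⟩)
      (mem_compTranslations.2 ⟨x', hx', y', hy', rfl⟩) (by rw [hxy, hxy']; linear_combination h)
  have hcrossBA : ∀ a ∈ A, ∀ a' ∈ A, ∀ b ∈ B, ∀ b' ∈ B, b - r * a = b' - r * a' → a = a' := by
    intro a ha a' ha' b hb b' hb' h
    obtain ⟨x, hx, y, hy, hxy⟩ := hBA b₀ hb₀ b hb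
    obtain ⟨x', hx', y', hy', hxy'⟩ := hBA b₀ hb₀ b' hb'
    have h2 : x + r * y + r * r * a = x' + r * y' + r * r * a' := by
      rw [hxy, hxy']
      linear_combination -r * h
    have h3 := hAA.fst_eq hA hU (mem_compTranslations.2 ⟨x, hx, y, hy, rfl⟩)
      (mem_compTranslations.2 ⟨x', hx', y', hy', rfl⟩) ha ha' h2
    rw [h3] at h2
    exact mul_left_cancel₀ (mul_pos hr hr).ne' (add_left_cancel h2)
  have hsummands := summands_eq_of_sums_eq
    (X := A.image fun a => a - a₀) (Y := A.image fun a => r * (a - a₀))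
    (X' := B.image fun b => b - b₀) (Y' := B.image fun b => r * (b₁ - b))
  simp only [Finset.mem_image, forall_exists_index, and_imp, forall_apply_eq_imp_iff₂,
    exists_exists_and_eq_and] at hsummands
  obtain ⟨hX, hY⟩ := hsummands
    (fun a ha => sub_nonneg.2 (hamin a ha))
    (fun a ha => mul_nonneg hr.le (sub_nonneg.2 (hamin a ha)))
    (fun b hb => sub_nonneg.2 (hbmin b hb))
    (fun b hb => mul_nonneg hr.le (sub_nonneg.2 (hbmax b hb)))
    a₀ ha₀ (by ring) a₀ ha₀ (by ring) b₀ hb₀ (by ring) b₁ hb₁ (by ring)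
    (fun a ha a' ha' x hx x' hx' h => by
      rw [hA.fst_eq hA hU ha hx ha' hx' (by linear_combination h)])
    (fun b hb b' hb' x hx x' hx' h => by
      rw [hB.fst_eq hB hV hb hx hb' hx' (by linear_combination h)])
    (fun a ha a' ha' => by
      obtain ⟨b, hb, b', hb', h⟩ := hAB a ha a' ha'
      exact ⟨b, hb, b', hb', by linear_combination -h - hmin⟩)
    (fun b hb b' hb' => by
      obtain ⟨a, ha, a', ha', h⟩ := hBA b hb b' hb'
      exact ⟨a, ha, a', ha', by linear_combination -h + hmin⟩)
    (by
      intro a ha b hb h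
      rw [hcrossAB a ha a₀ ha₀ b hb b₁ hb₁ (by linear_combination -h), sub_self])
    (by
      intro b hb a ha h
      rw [hcrossBA a ha a₀ ha₀ b hb b₀ hb₀ (by linear_combination -h)] at h
      linarith)
  refine attractor_symmetric (e := 2 * a₀ + b₁ - b₀) hr hr1 hKc hKne hA.cover hA.maps_attractor
    fun a ha => ?_
  obtain ⟨b, hb, h⟩ := Finset.mem_image.1 (hY ▸ Finset.mem_image_of_mem _ ha)
  have h' : b₁ - b = a - a₀ := mul_left_cancel₀ hr.ne' h
  obtain ⟨a', ha', h''⟩ := Finset.mem_image.1 (hX ▸ Finset.mem_image_of_mem _ hb)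
  convert ha' using 1
  linear_combination h' - h''
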